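/- arXiv:2604.25919 — 4 statements merged into one kernel-verified Lean document; each statement's English description precedes it below -/
import Mathlib

section
/- For all x, y in E with x ≠ y, one has ⟨f(x) − f(y), x − y⟩ > 0, where f(x) = x / (1 + (β ‖x‖)^α)^(1/α). (Strict monotonicity of the strain-limiting response map in the sense of the inner product, the property that rules out multiple solutions of the associated variational problem.) -/
open scoped RealInnerProductSpace

lemma strain_aux (α β : ℝ) (hα : 0 < α) (hβ : 0 < β) (a b : ℝ) (ha : 0 ≤ a) (hab : a < b) :
    ((1 + (β * a) ^ α) ^ (1 / α))⁻¹ * a < ((1 + (β * b) ^ α) ^ (1 / α))⁻¹ * b := by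
  have hb : 0 ≤ b := ha.trans hab.le
  have hA : 0 < (1 + (β * a) ^ α) ^ (1 / α) := by positivity
  have hB : 0 < (1 + (β * b) ^ α) ^ (1 / α) := by positivity
  have key : a * (1 + (β * b) ^ α) ^ (1 / α) < b * (1 + (β * a) ^ α) ^ (1 / α) := by
    have e : ∀ r s : ℝ, 0 ≤ r → 0 ≤ s → r * (1 + (β * s) ^ α) ^ (1 / α)
        = (r ^ α + β ^ α * (r ^ α * s ^ α)) ^ (1 / α) := by
      intro r s hr hs
      have h1 : r = (r ^ α) ^ (1 / α) := by
        rw [← Real.rpow_mul hr, mul_one_div_cancel hα.ne', Real.rpow_one]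
      conv_lhs => rw [h1]
      rw [← Real.mul_rpow (by positivity) (by positivity), Real.mul_rpow hβ.le hs]
      congr 1
      ring
    rw [e a b ha hb, e b a hb ha]
    apply Real.rpow_lt_rpow (by positivity) _ (by positivity)
    have := Real.rpow_lt_rpow ha hab hα
    rw [mul_comm (b ^ α) (a ^ α)]
    linarith
  rw [inv_mul_eq_div, inv_mul_eq_div, div_lt_div_iff₀ hA hB]
  exact key

theorem strain_limiting_map_strict_monotone
    {E : Type*} [NormedAddCommGroup E] [InnerProductSpace ℝ E]
    (α β : ℝ) (hα : 0 < α) (hβ : 0 < β)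
    (f : E → E) (hf : ∀ x, f x = ((1 + (β * ‖x‖) ^ α) ^ (1 / α))⁻¹ • x)
    (x y : E) (hxy : x ≠ y) :
    0 < ⟪f x - f y, x - y⟫ := by
  have hx : 0 < ((1 + (β * ‖x‖) ^ α) ^ (1 / α))⁻¹ := by positivity
  have hy : 0 < ((1 + (β * ‖y‖) ^ α) ^ (1 / α))⁻¹ := by positivity
  have hlt := strain_aux α β hα hβ ‖x‖ ‖y‖ (norm_nonneg x)
  have hgt := strain_aux α β hα hβ ‖y‖ ‖x‖ (norm_nonneg y)
  rw [hf x, hf y]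
  by_cases h : ‖x‖ = ‖y‖
  · rw [h, ← smul_sub, real_inner_smul_left]
    exact mul_pos hy (real_inner_self_pos.2 (sub_ne_zero.2 hxy))
  · generalize ((1 + (β * ‖x‖) ^ α) ^ (1 / α))⁻¹ = p at *
    generalize ((1 + (β * ‖y‖) ^ α) ^ (1 / α))⁻¹ = q at *
    have hcs := real_inner_le_norm x y
    have e : ⟪p • x - q • y, x - y⟫
        = (p * ‖x‖ - q * ‖y‖) * (‖x‖ - ‖y‖) + (p + q) * (‖x‖ * ‖y‖ - ⟪x, y⟫) := by
      simp only [inner_sub_left, inner_sub_right, real_inner_smul_left,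
        real_inner_self_eq_norm_sq, real_inner_comm x y]
      ring
    rw [e]
    have h2 : 0 ≤ (p + q) * (‖x‖ * ‖y‖ - ⟪x, y⟫) :=
      mul_nonneg (by linarith) (by linarith)
    have h1 : 0 < (p * ‖x‖ - q * ‖y‖) * (‖x‖ - ‖y‖) := by
      rcases lt_or_gt_of_ne h with h | h
      · exact mul_pos_of_neg_of_neg (by linarith [hlt h]) (by linarith)
      · exact mul_pos (by linarith [hgt h]) (by linarith)
    linarith
end

section
/- The strain-limiting response map f(x) = x / (1 + (β ‖x‖)^α)^(1/α) is globally Lipschitz continuous on E with Lipschitz constant 1: for all x, y in E, ‖f(x) − f(y)‖ ≤ ‖x − y‖. -/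
lemma slm_scalar (α β : ℝ) (hα : 0 < α) (hβ : 0 < β) (a b : ℝ) (hb : 0 ≤ b) (hab : b ≤ a) :
    |((1 + (β * a) ^ α) ^ (1 / α))⁻¹ * a - ((1 + (β * b) ^ α) ^ (1 / α))⁻¹ * b| ≤ |a - b| := by
  have ha : 0 ≤ a := hb.trans hab
  have hA : 0 ≤ (β * a) ^ α := by positivity
  have hB : 0 ≤ (β * b) ^ α := by positivity
  have hBA : (β * b) ^ α ≤ (β * a) ^ α := by gcongr
  have hP : 0 < (1 + (β * a) ^ α) ^ (1 / α) := by positivity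
  have hQ : 0 < (1 + (β * b) ^ α) ^ (1 / α) := by positivity
  have hQ1 : 1 ≤ (1 + (β * b) ^ α) ^ (1 / α) :=
    Real.one_le_rpow (by linarith) (by positivity)
  have hQP : (1 + (β * b) ^ α) ^ (1 / α) ≤ (1 + (β * a) ^ α) ^ (1 / α) := by gcongr
  have key : b * (1 + (β * a) ^ α) ^ (1 / α) ≤ a * (1 + (β * b) ^ α) ^ (1 / α) := by
    have e : ∀ t : ℝ, 0 ≤ t → t = (t ^ α) ^ (1 / α) := fun t ht => by
      rw [← Real.rpow_mul ht, mul_one_div_cancel hα.ne', Real.rpow_one]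
    have hba : b ^ α ≤ a ^ α := by gcongr
    calc b * (1 + (β * a) ^ α) ^ (1 / α)
        = (b ^ α * (1 + (β * a) ^ α)) ^ (1 / α) := by
          rw [Real.mul_rpow (x := b ^ α) (by positivity) (by positivity), ← e b hb]
      _ ≤ (a ^ α * (1 + (β * b) ^ α)) ^ (1 / α) := by
          apply Real.rpow_le_rpow (by positivity) _ (by positivity)
          rw [Real.mul_rpow hβ.le ha, Real.mul_rpow hβ.le hb]
          nlinarith
      _ = a * (1 + (β * b) ^ α) ^ (1 / α) := by
          rw [Real.mul_rpow (x := a ^ α) (by positivity) (by positivity), ← e a ha]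
  generalize (1 + (β * a) ^ α) ^ (1 / α) = P at *
  generalize (1 + (β * b) ^ α) ^ (1 / α) = Q at *
  have h1 : Q⁻¹ * b ≤ P⁻¹ * a := by
    rw [inv_mul_eq_div, inv_mul_eq_div, div_le_div_iff₀ hQ hP]; exact key
  have h2 : P⁻¹ ≤ Q⁻¹ := by gcongr
  have h3 : Q⁻¹ ≤ 1 := inv_le_one_of_one_le₀ hQ1
  rw [abs_of_nonneg (by linarith), abs_of_nonneg (by linarith)]
  nlinarith [mul_nonneg ha (sub_nonneg.2 h2), mul_nonneg (sub_nonneg.2 hab) (sub_nonneg.2 h3)]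

theorem strain_limiting_map_lipschitz
    {E : Type*} [NormedAddCommGroup E] [InnerProductSpace ℝ E]
    (α β : ℝ) (hα : 0 < α) (hβ : 0 < β)
    (f : E → E) (hf : ∀ x, f x = ((1 + (β * ‖x‖) ^ α) ^ (1 / α))⁻¹ • x)
    (x y : E) :
    ‖f x - f y‖ ≤ ‖x - y‖ := by
  have hs : |((1 + (β * ‖x‖) ^ α) ^ (1 / α))⁻¹ * ‖x‖
      - ((1 + (β * ‖y‖) ^ α) ^ (1 / α))⁻¹ * ‖y‖| ≤ |‖x‖ - ‖y‖| := by
    rcases le_total ‖y‖ ‖x‖ with h | h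
    · exact slm_scalar α β hα hβ _ _ (norm_nonneg _) h
    · rw [abs_sub_comm, abs_sub_comm ‖x‖]
      exact slm_scalar α β hα hβ _ _ (norm_nonneg _) h
  have hφ : ∀ z : E, 0 ≤ ((1 + (β * ‖z‖) ^ α) ^ (1 / α))⁻¹ ∧
      ((1 + (β * ‖z‖) ^ α) ^ (1 / α))⁻¹ ≤ 1 := fun z => by
    have h0 : 0 ≤ (β * ‖z‖) ^ α := by positivity
    exact ⟨by positivity,
      inv_le_one_of_one_le₀ (Real.one_le_rpow (by linarith) (by positivity))⟩
  obtain ⟨hp0, hp1⟩ := hφ x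
  obtain ⟨hq0, hq1⟩ := hφ y
  rw [hf x, hf y]
  generalize ((1 + (β * ‖x‖) ^ α) ^ (1 / α))⁻¹ = p at *
  generalize ((1 + (β * ‖y‖) ^ α) ^ (1 / α))⁻¹ = q at *
  have hs2 := sq_le_sq.2 hs
  have hc := real_inner_le_norm x y
  have hpq : p * q ≤ 1 := mul_le_one₀ hp1 hq0 hq1
  refine (sq_le_sq₀ (norm_nonneg _) (norm_nonneg _)).1 ?_
  rw [norm_sub_sq_real, norm_sub_sq_real, norm_smul, norm_smul, real_inner_smul_left,
    real_inner_smul_right, Real.norm_of_nonneg hp0, Real.norm_of_nonneg hq0]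
  nlinarith [mul_nonneg (sub_nonneg.2 hpq) (sub_nonneg.2 hc)]
end

section
/- Define Φ : E → ℝ by Φ(x) = ∫₀^{‖x‖} g_{α,β}(t) dt, where g_{α,β}(t) = t / (1 + (β t)^α)^(1/α). Then for every x in E, Φ has a gradient at x equal to f(x) = x / (1 + (β ‖x‖)^α)^(1/α). (The strain-limiting constitutive relation is hyperelastic: the response map derives from a scalar potential.) -/
theorem strain_limiting_hyperelastic_potential
    {E : Type*} [NormedAddCommGroup E] [InnerProductSpace ℝ E] [CompleteSpace E]
    (α β : ℝ) (hα : 0 < α) (hβ : 0 < β)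
    (f : E → E) (hf : ∀ x, f x = ((1 + (β * ‖x‖) ^ α) ^ (1 / α))⁻¹ • x)
    (Φ : E → ℝ)
    (hΦ : ∀ x, Φ x = ∫ t in (0 : ℝ)..‖x‖, t / (1 + (β * t) ^ α) ^ (1 / α))
    (x : E) :
    HasGradientAt Φ (f x) x := by
  have hpos : ∀ t : ℝ, 0 < 1 + (β * |t|) ^ α := fun t => by positivity
  have hcont : Continuous (fun t : ℝ => t / (1 + (β * |t|) ^ α) ^ (1 / α)) := by
    have h1 : Continuous (fun t : ℝ => 1 + (β * |t|) ^ α) :=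
      continuous_const.add
        ((continuous_const.mul continuous_abs).rpow_const (fun _ => Or.inr hα.le))
    refine continuous_id.div (h1.rpow_const (fun t => Or.inl (hpos t).ne')) ?_
    intro t
    exact (Real.rpow_pos_of_pos (hpos t) _).ne'
  have hG : ∀ s : ℝ, HasDerivAt
      (fun u : ℝ => ∫ t in (0 : ℝ)..u, t / (1 + (β * |t|) ^ α) ^ (1 / α))
      (s / (1 + (β * |s|) ^ α) ^ (1 / α)) s := fun s =>
    intervalIntegral.integral_hasDerivAt_right (hcont.intervalIntegrable _ _)
      (hcont.stronglyMeasurableAtFilter _ _) hcont.continuousAt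
  have hΦ' : Φ = fun y => (fun u : ℝ => ∫ t in (0 : ℝ)..u,
      t / (1 + (β * |t|) ^ α) ^ (1 / α)) ‖y‖ := by
    funext y
    rw [hΦ]
    apply intervalIntegral.integral_congr
    intro t ht
    rw [Set.uIcc_of_le (norm_nonneg y)] at ht
    simp only [abs_of_nonneg ht.1]
  rw [hΦ', hf]
  generalize hGG : (fun u : ℝ => ∫ t in (0 : ℝ)..u,
      t / (1 + (β * |t|) ^ α) ^ (1 / α)) = G at hG ⊢
  by_cases hx : x = 0
  · subst hx
    have h0 := hG 0
    have hG0 : G 0 = 0 := by rw [← hGG]; simp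
    rw [hasDerivAt_iff_isLittleO] at h0
    rw [hasGradientAt_iff_isLittleO]
    have ht : Filter.Tendsto (fun y : E => ‖y‖) (nhds 0) (nhds 0) := by
      simpa using (continuous_norm (E := E)).tendsto 0
    have := h0.comp_tendsto ht
    simp only [Function.comp_def, zero_div, smul_zero, sub_zero, hG0] at this
    simpa [hG0] using this.of_norm_right
  · have hn : 0 < ‖x‖ := norm_pos_iff.mpr hx
    have h1 := (hasStrictFDerivAt_norm_sq x).hasFDerivAt.sqrt (by positivity)
    have h2 : (fun y : E => √(‖y‖ ^ 2)) = fun y => ‖y‖ := by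
      funext y; exact Real.sqrt_sq (norm_nonneg y)
    simp only [h2, Real.sqrt_sq hn.le] at h1
    have h3 := (hG ‖x‖).comp_hasFDerivAt x h1
    rw [hasGradientAt_iff_hasFDerivAt]
    refine h3.congr_fderiv ?_
    ext y
    have hp := Real.rpow_pos_of_pos (hpos ‖x‖) (1 / α)
    simp only [abs_norm] at hp
    simp
    field_simp
end

section
/- The strain-limiting response map f(x) = x / (1 + (β ‖x‖)^α)^(1/α) is a bijection from E onto the open ball { y ∈ E : ‖y‖ < 1/β }, and its inverse is given explicitly by y ↦ y / (1 − (β ‖y‖)^α)^(1/α): for every x in E one has ‖f(x)‖ < 1/β and f(x) / (1 − (β ‖f(x)‖)^α)^(1/α) = x, and for every y in E with ‖y‖ < 1/β one has f( y / (1 − (β ‖y‖)^α)^(1/α) ) = y. (Invertibility of the constitutive relation: the Cauchy stress can be expressed as a nonlinear function of the bounded linearized strain, and vice versa.) -/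
theorem slm_key {E : Type*} [NormedAddCommGroup E] [InnerProductSpace ℝ E]
    (α β : ℝ) (hα : 0 < α) (hβ : 0 < β) (c : ℝ) (hc : 0 < c) (x : E) :
    (β * ‖(c ^ (1 / α))⁻¹ • x‖) ^ α = (β * ‖x‖) ^ α / c := by
  have hp : 0 < c ^ (1 / α) := Real.rpow_pos_of_pos hc _
  have h1 : β * ‖(c ^ (1 / α))⁻¹ • x‖ = (β * ‖x‖) / c ^ (1 / α) := by
    rw [norm_smul, Real.norm_of_nonneg (inv_nonneg.mpr hp.le)]
    field_simp
  rw [h1, Real.div_rpow (by positivity) hp.le, ← Real.rpow_mul hc.le,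
    one_div_mul_cancel hα.ne', Real.rpow_one]

theorem strain_limiting_map_bijective_inverse
    {E : Type*} [NormedAddCommGroup E] [InnerProductSpace ℝ E]
    (α β : ℝ) (hα : 0 < α) (hβ : 0 < β)
    (f : E → E) (hf : ∀ x, f x = ((1 + (β * ‖x‖) ^ α) ^ (1 / α))⁻¹ • x) :
    (∀ x : E, ‖f x‖ < 1 / β ∧
      ((1 - (β * ‖f x‖) ^ α) ^ (1 / α))⁻¹ • f x = x) ∧
    (∀ y : E, ‖y‖ < 1 / β →
      f (((1 - (β * ‖y‖) ^ α) ^ (1 / α))⁻¹ • y) = y) := by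
  constructor
  · intro x
    have ht : 0 ≤ (β * ‖x‖) ^ α := by positivity
    have hc : 0 < 1 + (β * ‖x‖) ^ α := by linarith
    have hk := slm_key α β hα hβ _ hc x
    rw [← hf x] at hk
    have hp := Real.rpow_pos_of_pos hc (1 / α)
    constructor
    · have h1 : (β * ‖f x‖) ^ α < 1 ^ α := by
        rw [hk, Real.one_rpow, div_lt_one hc]
        linarith
      have h2 := (Real.rpow_lt_rpow_iff (by positivity) zero_le_one hα).mp h1
      rw [lt_div_iff₀ hβ]
      linarith
    · have h3 : 1 - (β * ‖f x‖) ^ α = (1 + (β * ‖x‖) ^ α)⁻¹ := by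
        rw [hk]
        field_simp
        ring
      rw [h3, Real.inv_rpow hc.le, inv_inv, hf x, smul_smul, mul_inv_cancel₀ hp.ne', one_smul]
  · intro y hy
    have h1 : (β * ‖y‖) ^ α < 1 := by
      rw [lt_div_iff₀ hβ] at hy
      exact Real.rpow_lt_one (by positivity) (by linarith) hα
    have hc : 0 < 1 - (β * ‖y‖) ^ α := by linarith
    have hp := Real.rpow_pos_of_pos hc (1 / α)
    have h3 : 1 + (β * ‖y‖) ^ α / (1 - (β * ‖y‖) ^ α) = (1 - (β * ‖y‖) ^ α)⁻¹ := by
      field_simp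
      ring
    rw [hf, slm_key α β hα hβ _ hc y, h3, Real.inv_rpow hc.le, inv_inv, smul_smul,
      mul_inv_cancel₀ hp.ne', one_smul]
end
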